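/- Let α > 0 be a constant, β : ℝ → ℝ continuous, and let u, f : [0,∞) × [0,∞) → ℂ satisfy: (i) u is twice continuously differentiable in x and once in t, with ∂ₜ∂ₓₓu jointly continuous; (ii) for every T > 0 there is an integrable function F : [0,∞) → ℝ dominating |∂ₓʲ∂ₜᵏ u(x,t)| and |f(x,t)| for 0 ≤ t ≤ T, 0 ≤ j ≤ 2, 0 ≤ k ≤ 1; (iii) ∂ₓʲ u(x,t) → 0 as x → ∞ for j = 0, 1 and each t; (iv) ∂ₜu = α·∂ₜ∂ₓₓu − β(t)·∂ₓu + f on (0,∞) × (0,∞). Define g₀(t) = u(0,t), g₁(t) = ∂ₓu(0,t), û(λ,t) = ∫₀^∞ u(x,t)e^{−iλx}dx, f̂(λ,t) = ∫₀^∞ f(x,t)e^{−iλx}dx, and Ω(λ,t) = (iλ/(1+αλ²))·∫₀ᵗ β(τ)dτ. Then for every real λ and t ≥ 0: û(λ,t) = e^{−Ω(λ,t)} û(λ,0) + (e^{−Ω(λ,t)}/(1+αλ²)) ∫₀ᵗ e^{Ω(λ,τ)} ( β(τ)g₀(τ) − iαλ g₀′(τ) − α g₁′(τ) + f̂(λ,τ)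 ) dτ. -/

import Mathlib

open MeasureTheory Filter Topology

theorem aux_norm (lam x : ℝ) : ‖Complex.exp (-(Complex.I * lam * x))‖ = 1 := by
  have : -(Complex.I * lam * x) = ((-(lam * x) : ℝ) : ℂ) * Complex.I := by push_cast; ring
  rw [this, Complex.norm_exp_ofReal_mul_I]

theorem aux_meas (g : ℝ → ℝ → ℂ) (lam : ℝ)
    (hc : ContinuousOn (fun p : ℝ × ℝ => g p.1 p.2) (Set.Ici 0 ×ˢ Set.Ici 0))
    (t : ℝ) (ht : 0 ≤ t) :
    AEStronglyMeasurable (fun x : ℝ => g x t * Complex.exp (-(Complex.I * lam * x)))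
      (volume.restrict (Set.Ici 0)) := by
  apply ContinuousOn.aestronglyMeasurable _ measurableSet_Ici
  apply ContinuousOn.mul
  · exact hc.comp (f := fun x : ℝ => (x, t)) (by fun_prop) (fun x hx => ⟨hx, ht⟩)
  · fun_prop

theorem aux_int (g : ℝ → ℝ → ℂ) (lam : ℝ) (F : ℝ → ℝ) (T : ℝ)
    (hc : ContinuousOn (fun p : ℝ × ℝ => g p.1 p.2) (Set.Ici 0 ×ˢ Set.Ici 0))
    (hF : IntegrableOn F (Set.Ici 0))
    (hd : ∀ x ∈ Set.Ici (0:ℝ), ∀ t ∈ Set.Icc (0:ℝ) T, ‖g x t‖ ≤ F x)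
    (t : ℝ) (ht : t ∈ Set.Icc 0 T) :
    IntegrableOn (fun x : ℝ => g x t * Complex.exp (-(Complex.I * lam * x))) (Set.Ici 0) := by
  refine Integrable.mono' hF (aux_meas g lam hc t ht.1) ?_
  filter_upwards [ae_restrict_mem measurableSet_Ici] with x hx
  rw [norm_mul, aux_norm, mul_one]
  exact hd x hx t ht

theorem aux_cont (g : ℝ → ℝ → ℂ) (lam : ℝ) (F : ℝ → ℝ) (T : ℝ)
    (hc : ContinuousOn (fun p : ℝ × ℝ => g p.1 p.2) (Set.Ici 0 ×ˢ Set.Ici 0))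
    (hF : IntegrableOn F (Set.Ici 0))
    (hd : ∀ x ∈ Set.Ici (0:ℝ), ∀ t ∈ Set.Icc (0:ℝ) T, ‖g x t‖ ≤ F x) :
    ContinuousOn (fun t => ∫ x in Set.Ici (0:ℝ), g x t * Complex.exp (-(Complex.I * lam * x)))
      (Set.Icc 0 T) := by
  refine continuousOn_of_dominated (bound := F) (fun t ht => aux_meas g lam hc t ht.1) ?_ hF ?_
  · intro t ht
    filter_upwards [ae_restrict_mem measurableSet_Ici] with x hx
    rw [norm_mul, aux_norm, mul_one]
    exact hd x hx t ht
  · filter_upwards [ae_restrict_mem measurableSet_Ici] with x hx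
    apply ContinuousOn.mul _ continuousOn_const
    exact hc.comp (f := fun t : ℝ => (x, t)) (by fun_prop) (fun t ht => ⟨hx, ht.1⟩)

theorem aux_deriv (g gt : ℝ → ℝ → ℂ) (lam : ℝ) (F : ℝ → ℝ) (T : ℝ)
    (hc : ContinuousOn (fun p : ℝ × ℝ => g p.1 p.2) (Set.Ici 0 ×ˢ Set.Ici 0))
    (hc' : ContinuousOn (fun p : ℝ × ℝ => gt p.1 p.2) (Set.Ici 0 ×ˢ Set.Ici 0))
    (hF : IntegrableOn F (Set.Ici 0))
    (hd : ∀ x ∈ Set.Ici (0:ℝ), ∀ t ∈ Set.Icc (0:ℝ) T, ‖g x t‖ ≤ F x)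
    (hd' : ∀ x ∈ Set.Ici (0:ℝ), ∀ t ∈ Set.Icc (0:ℝ) T, ‖gt x t‖ ≤ F x)
    (hg : ∀ x ∈ Set.Ici (0:ℝ), ∀ t ∈ Set.Ici (0:ℝ), HasDerivAt (fun t' => g x t') (gt x t) t)
    (t : ℝ) (ht : t ∈ Set.Ioo 0 T) :
    HasDerivAt (fun t => ∫ x in Set.Ici (0:ℝ), g x t * Complex.exp (-(Complex.I * lam * x)))
      (∫ x in Set.Ici (0:ℝ), gt x t * Complex.exp (-(Complex.I * lam * x))) t := by
  refine (hasDerivAt_integral_of_dominated_loc_of_deriv_le (μ := volume.restrict (Set.Ici (0:ℝ)))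
    (F := fun t x => g x t * Complex.exp (-(Complex.I * lam * x)))
    (F' := fun t x => gt x t * Complex.exp (-(Complex.I * lam * x)))
    (bound := F) (s := Set.Ioo 0 T) (Ioo_mem_nhds ht.1 ht.2) ?_ ?_ ?_ ?_ hF ?_).2
  · filter_upwards [Ioo_mem_nhds ht.1 ht.2] with s hs
    exact aux_meas g lam hc s hs.1.le
  · exact aux_int g lam F T hc hF hd t ⟨ht.1.le, ht.2.le⟩
  · exact aux_meas gt lam hc' t ht.1.le
  · filter_upwards [ae_restrict_mem measurableSet_Ici] with x hx s hs
    rw [norm_mul, aux_norm, mul_one]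
    exact hd' x hx s ⟨hs.1.le, hs.2.le⟩
  · filter_upwards [ae_restrict_mem measurableSet_Ici] with x hx s hs
    exact (hg x hx s hs.1.le).mul_const _

theorem aux_ibp (g gx : ℝ → ℂ) (lam : ℝ)
    (hg : ∀ x ∈ Set.Ici (0:ℝ), HasDerivAt g (gx x) x)
    (hi : IntegrableOn (fun x : ℝ => g x * Complex.exp (-(Complex.I * lam * x))) (Set.Ici 0))
    (hi' : IntegrableOn (fun x : ℝ => gx x * Complex.exp (-(Complex.I * lam * x))) (Set.Ici 0))
    (h0 : Tendsto g atTop (𝓝 0)) :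
    (∫ x in Set.Ici (0:ℝ), gx x * Complex.exp (-(Complex.I * lam * x)))
      = - g 0 + Complex.I * lam *
        ∫ x in Set.Ici (0:ℝ), g x * Complex.exp (-(Complex.I * lam * x)) := by
  have hD : ∀ x ∈ Set.Ici (0:ℝ), HasDerivAt
      (fun x : ℝ => g x * Complex.exp (-(Complex.I * lam * x)))
      (gx x * Complex.exp (-(Complex.I * lam * x))
        - Complex.I * lam * (g x * Complex.exp (-(Complex.I * lam * x)))) x := by
    intro x hx
    have h1 : HasDerivAt (fun x : ℝ => -(Complex.I * lam * (x:ℂ))) (-(Complex.I * lam * 1)) x :=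
      ((HasDerivAt.ofReal_comp (hasDerivAt_id x)).const_mul _).neg
    refine ((hg x hx).mul h1.cexp).congr_deriv ?_
    ring
  have hT : Tendsto (fun x : ℝ => g x * Complex.exp (-(Complex.I * lam * x))) atTop (𝓝 0) := by
    rw [tendsto_zero_iff_norm_tendsto_zero] at h0 ⊢
    simpa only [norm_mul, aux_norm, mul_one] using h0
  rw [integrableOn_Ici_iff_integrableOn_Ioi] at hi hi'
  have := integral_Ioi_of_hasDerivAt_of_tendsto' hD (hi'.sub (hi.const_mul _)) hT
  rw [integral_sub hi' (hi.const_mul _), integral_const_mul] at this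
  rw [integral_Ici_eq_integral_Ioi, integral_Ici_eq_integral_Ioi]
  simp only [Complex.ofReal_zero, mul_zero, neg_zero, Complex.exp_zero, mul_one] at this
  linear_combination this



/-- Global relation (3.3) for the BBM-type operator
    ∂ₜ − α∂ₓₓ∂ₜ + β(t)∂ₓ on the half-line. -/
theorem stmt6
    (α : ℝ) (hα : 0 < α) (β : ℝ → ℝ) (hβ : Continuous β)
    (u ux uxx ut utx utxx f : ℝ → ℝ → ℂ)
    -- (i) differentiability: twice in x, once in t, mixed derivative ∂ₜ∂ₓₓu exists
    (hux : ∀ t ∈ Set.Ici (0:ℝ), ∀ x ∈ Set.Ici (0:ℝ),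
      HasDerivAt (fun x' => u x' t) (ux x t) x)
    (huxx : ∀ t ∈ Set.Ici (0:ℝ), ∀ x ∈ Set.Ici (0:ℝ),
      HasDerivAt (fun x' => ux x' t) (uxx x t) x)
    (hut : ∀ x ∈ Set.Ici (0:ℝ), ∀ t ∈ Set.Ici (0:ℝ),
      HasDerivAt (fun t' => u x t') (ut x t) t)
    (hutx : ∀ x ∈ Set.Ici (0:ℝ), ∀ t ∈ Set.Ici (0:ℝ),
      HasDerivAt (fun t' => ux x t') (utx x t) t)
    (hutxx : ∀ x ∈ Set.Ici (0:ℝ), ∀ t ∈ Set.Ici (0:ℝ),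
      HasDerivAt (fun t' => uxx x t') (utxx x t) t)
    -- (i) joint continuity of u, its derivatives, and f
    (hcont : ∀ g ∈ [u, ux, uxx, ut, utx, utxx, f],
      ContinuousOn (fun p : ℝ × ℝ => g p.1 p.2) (Set.Ici 0 ×ˢ Set.Ici 0))
    -- (ii) uniform integrable domination on time strips
    (hdom : ∀ T > (0:ℝ), ∃ F : ℝ → ℝ, IntegrableOn F (Set.Ici 0) ∧
      ∀ g ∈ [u, ux, uxx, ut, utx, utxx, f],
        ∀ x ∈ Set.Ici (0:ℝ), ∀ t ∈ Set.Icc (0:ℝ) T, ‖g x t‖ ≤ F x)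
    -- (iii) decay of u and uₓ as x → ∞
    (hdecay : ∀ t ∈ Set.Ici (0:ℝ),
      Tendsto (fun x => u x t) atTop (𝓝 0) ∧ Tendsto (fun x => ux x t) atTop (𝓝 0))
    -- (iv) the PDE
    (hpde : ∀ x > (0:ℝ), ∀ t > (0:ℝ),
      ut x t = (α : ℂ) * utxx x t - (β t : ℂ) * ux x t + f x t) :
    ∀ lam : ℝ, ∀ t ≥ (0:ℝ),
      (∫ x in Set.Ici (0:ℝ), u x t * Complex.exp (-(Complex.I * lam * x)))
        = Complex.exp (-(Complex.I * lam / (1 + (α : ℂ) * lam ^ 2) *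
              ((∫ τ in (0:ℝ)..t, β τ : ℝ) : ℂ))) *
            (∫ x in Set.Ici (0:ℝ), u x 0 * Complex.exp (-(Complex.I * lam * x)))
          + (Complex.exp (-(Complex.I * lam / (1 + (α : ℂ) * lam ^ 2) *
              ((∫ τ in (0:ℝ)..t, β τ : ℝ) : ℂ))) / (1 + (α : ℂ) * lam ^ 2)) *
            ∫ τ in (0:ℝ)..t,
              Complex.exp (Complex.I * lam / (1 + (α : ℂ) * lam ^ 2) *
                ((∫ s in (0:ℝ)..τ, β s : ℝ) : ℂ)) *
              ((β τ : ℂ) * u 0 τ - Complex.I * (α : ℂ) * lam * ut 0 τ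
                - (α : ℂ) * utx 0 τ
                + ∫ x in Set.Ici (0:ℝ), f x τ * Complex.exp (-(Complex.I * lam * x))) := by
  intro lam t ht
  have hT : 0 < t + 1 := by linarith
  obtain ⟨F, hF, hd⟩ := hdom (t + 1) hT
  have hne : (1 + (α : ℂ) * lam ^ 2) ≠ 0 := by
    have : (0:ℝ) < 1 + α * lam ^ 2 := by positivity
    exact_mod_cast this.ne'
  have hI : ∀ g ∈ [u, ux, uxx, ut, utx, utxx, f], ∀ s ∈ Set.Icc (0:ℝ) (t+1),
      IntegrableOn (fun x : ℝ => g x s * Complex.exp (-(Complex.I * lam * x))) (Set.Ici 0) :=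
    fun g hg s hs => aux_int g lam F (t+1) (hcont g hg) hF (hd g hg) s hs
  have hC : ∀ g ∈ [u, ux, uxx, ut, utx, utxx, f], ContinuousOn
      (fun s => ∫ x in Set.Ici (0:ℝ), g x s * Complex.exp (-(Complex.I * lam * x)))
      (Set.Icc 0 t) :=
    fun g hg => (aux_cont g lam F (t+1) (hcont g hg) hF (hd g hg)).mono
      (Set.Icc_subset_Icc_right (by linarith))
  have hC0 : ∀ g ∈ [u, ux, uxx, ut, utx, utxx, f], ContinuousOn (fun s => g 0 s)
      (Set.Icc 0 t) := fun g hg =>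
    (hcont g hg).comp (f := fun s : ℝ => ((0:ℝ), s)) (by fun_prop)
      (fun s hs => ⟨Set.self_mem_Ici, hs.1⟩)
  -- spatial integration by parts
  have hX : ∀ s ∈ Set.Icc (0:ℝ) (t+1),
      (∫ x in Set.Ici (0:ℝ), ux x s * Complex.exp (-(Complex.I * lam * x)))
      = - u 0 s + Complex.I * lam *
        ∫ x in Set.Ici (0:ℝ), u x s * Complex.exp (-(Complex.I * lam * x)) := fun s hs =>
    aux_ibp (fun x => u x s) (fun x => ux x s) lam (hux s hs.1) (hI u (by simp) s hs)
      (hI ux (by simp) s hs) (hdecay s hs.1).1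
  have hXX : ∀ s ∈ Set.Icc (0:ℝ) (t+1),
      (∫ x in Set.Ici (0:ℝ), uxx x s * Complex.exp (-(Complex.I * lam * x)))
      = - ux 0 s + Complex.I * lam *
        ∫ x in Set.Ici (0:ℝ), ux x s * Complex.exp (-(Complex.I * lam * x)) := fun s hs =>
    aux_ibp (fun x => ux x s) (fun x => uxx x s) lam (huxx s hs.1) (hI ux (by simp) s hs)
      (hI uxx (by simp) s hs) (hdecay s hs.1).2
  have hDu : ∀ s ∈ Set.Ioo (0:ℝ) (t+1), _ := aux_deriv u ut lam F (t+1) (hcont u (by simp))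
    (hcont ut (by simp)) hF (hd u (by simp)) (hd ut (by simp)) hut
  have hDuxx : ∀ s ∈ Set.Ioo (0:ℝ) (t+1), _ := aux_deriv uxx utxx lam F (t+1)
    (hcont uxx (by simp)) (hcont utxx (by simp)) hF (hd uxx (by simp)) (hd utxx (by simp)) hutxx
  set U : ℝ → ℂ := fun s => ∫ x in Set.Ici (0:ℝ), u x s * Complex.exp (-(Complex.I * lam * x))
    with hU
  set Ut : ℝ → ℂ := fun s => ∫ x in Set.Ici (0:ℝ), ut x s * Complex.exp (-(Complex.I * lam * x))
    with hUt
  set fh : ℝ → ℂ := fun s => ∫ x in Set.Ici (0:ℝ), f x s * Complex.exp (-(Complex.I * lam * x))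
    with hfh
  have hTXX : ∀ s ∈ Set.Ioo (0:ℝ) (t+1),
      (∫ x in Set.Ici (0:ℝ), utxx x s * Complex.exp (-(Complex.I * lam * x)))
      = - utx 0 s + Complex.I * lam * (- ut 0 s + Complex.I * lam * Ut s) := by
    intro s hs
    have h1 : HasDerivAt (fun s => - ux 0 s + Complex.I * lam * (- u 0 s + Complex.I * lam * U s))
        (- utx 0 s + Complex.I * lam * (- ut 0 s + Complex.I * lam * Ut s)) s :=
      (hutx 0 Set.self_mem_Ici s hs.1.le).neg.add
        (((hut 0 Set.self_mem_Ici s hs.1.le).neg.add ((hDu s hs).const_mul _)).const_mul _)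
    refine (hDuxx s hs).unique (h1.congr_of_eventuallyEq ?_)
    filter_upwards [Ioo_mem_nhds hs.1 hs.2] with r hr
    have hr' : r ∈ Set.Icc (0:ℝ) (t+1) := ⟨hr.1.le, hr.2.le⟩
    rw [hXX r hr', hX r hr']
  have hP : ∀ s ∈ Set.Ioo (0:ℝ) (t+1), (1 + (α : ℂ) * lam ^ 2) * Ut s =
      - (Complex.I * lam * β s * U s) + ((β s : ℂ) * u 0 s - Complex.I * (α : ℂ) * lam * ut 0 s
                - (α : ℂ) * utx 0 s + fh s) := by
    intro s hs
    have hs' : s ∈ Set.Icc (0:ℝ) (t+1) := ⟨hs.1.le, hs.2.le⟩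
    have h1 : Ut s = (α : ℂ) * (∫ x in Set.Ici (0:ℝ), utxx x s * Complex.exp (-(Complex.I * lam * x)))
        - β s * (∫ x in Set.Ici (0:ℝ), ux x s * Complex.exp (-(Complex.I * lam * x))) + fh s := by
      have i1 := (hI utxx (by simp) s hs').const_mul (α : ℂ)
      have i2 := (hI ux (by simp) s hs').const_mul (β s : ℂ)
      have i3 := hI f (by simp) s hs'
      simp only [hUt, hfh]
      rw [← integral_const_mul, ← integral_const_mul, ← integral_sub i1 i2,
        ← integral_add (by exact i1.sub i2) i3]
      simp only [integral_Ici_eq_integral_Ioi]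
      refine setIntegral_congr_fun measurableSet_Ioi fun x hx => ?_
      simp only [hpde x hx s hs.1]
      ring
    rw [hTXX s hs, hX s hs'] at h1
    linear_combination h1 + (α * lam^2 * Ut s) * Complex.I_sq
  set c : ℂ := Complex.I * lam / (1 + (α : ℂ) * lam ^ 2) with hc
  set B : ℝ → ℂ := fun s => ((∫ τ in (0:ℝ)..s, β τ : ℝ) : ℂ) with hB
  have hBd : ∀ s, HasDerivAt B (β s) s := fun s =>
    (intervalIntegral.integral_hasDerivAt_right (hβ.intervalIntegrable _ _)
      (hβ.stronglyMeasurableAtFilter _ _) hβ.continuousAt).ofReal_comp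
  have hBc : Continuous B := continuous_iff_continuousAt.2 fun s => (hBd s).continuousAt
  set G : ℝ → ℂ := fun s => (β s : ℂ) * u 0 s - Complex.I * (α : ℂ) * lam * ut 0 s
                - (α : ℂ) * utx 0 s + fh s with hG
  have hGc : ContinuousOn (fun s => Complex.exp (c * B s) * G s) (Set.Icc 0 t) := by
    have a1 := hC0 u (by simp)
    have a2 := hC0 ut (by simp)
    have a3 := hC0 utx (by simp)
    have a4 : ContinuousOn fh (Set.Icc 0 t) := hC f (by simp)
    fun_prop
  have key := intervalIntegral.integral_eq_sub_of_hasDerivAt_of_le ht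
    (f := fun s => (1 + (α : ℂ) * lam ^ 2) * (Complex.exp (c * B s) * U s))
    (f' := fun s => Complex.exp (c * B s) * G s) ?_ ?_
    (by rw [intervalIntegrable_iff_integrableOn_Icc_of_le ht]; exact hGc.integrableOn_Icc)
  · change U t = Complex.exp (-(c * B t)) * U 0 + Complex.exp (-(c * B t)) /
      (1 + (α : ℂ) * lam ^ 2) * ∫ τ in (0:ℝ)..t, Complex.exp (c * B τ) * G τ
    have hB0 : B 0 = 0 := by simp [hB]
    have he : Complex.exp (-(c * B t)) * Complex.exp (c * B t) = 1 := by
      rw [← Complex.exp_add]; simp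
    rw [key]
    simp only [hB0, mul_zero, Complex.exp_zero, one_mul]
    field_simp
    linear_combination (-U t) * he
  · have a1 : ContinuousOn U (Set.Icc 0 t) := hC u (by simp)
    fun_prop
  · intro s hs
    have hs' : s ∈ Set.Ioo (0:ℝ) (t+1) := ⟨hs.1, by linarith [hs.2]⟩
    have h1 := ((((hBd s).const_mul c).cexp).mul (hDu s hs')).const_mul (1 + (α : ℂ) * lam ^ 2)
    refine h1.congr_deriv (Eq.symm ?_)
    have h2 := hP s hs'
    have h3 : c * (1 + (α : ℂ) * lam ^ 2) = Complex.I * lam := by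
      rw [hc]; exact div_mul_cancel₀ _ hne
    change Complex.exp (c * B s) * G s = (1 + (α : ℂ) * lam ^ 2) *
      (Complex.exp (c * B s) * (c * β s) * U s + Complex.exp (c * B s) * Ut s)
    linear_combination (-Complex.exp (c * B s)) * h2 - Complex.exp (c * B s) * β s * U s * h3
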